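/- Lasota–Yorke inequality for the transfer operator: Let f : 𝕋 → 𝕋 be a C² map of the circle with f' ≥ λ for some λ > 1, and set B = ‖f''/(f')²‖_∞. For ρ ∈ C¹(𝕋,ℂ) define (Lρ)(θ) = ∑_{y ∈ f^{−1}(θ)} ρ(y)/f'(y). Then Lρ ∈ C¹(𝕋,ℂ) with (Lρ)' = L(ρ'/f') − L((f''/(f')²)·ρ), and the bounds ‖Lρ‖_{L¹} ≤ ‖ρ‖_{L¹} and ‖(Lρ)'‖_{L¹} ≤ λ^{−1} ‖ρ'‖_{L¹} + B ‖ρ‖_{L¹} hold. Moreover, for any a > B/(1−λ^{−1}), if ρ > 0 and |ρ'| ≤ a ρ pointwise, then Lρ > 0 and |(Lρ)'| ≤ a·Lρ pointwise. -/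

import Mathlib

/-!
Statement 15: Lasota–Yorke inequality for the transfer operator of an expanding
circle map.  The circle map is given by a lift `F : ℝ → ℝ` of degree `d ≥ 2`
(`F(x+1) = F x + d`) which is a bijection of `ℝ`, so the transfer operator
`(Lρ)(θ) = ∑_{y ∈ f^{-1}θ} ρ(y)/f'(y)` can be written concretely as
`(Lρ)(θ) = ∑_{i<d} ρ(F⁻¹(θ+i)) / F'(F⁻¹(θ+i))`.
-/

open MeasureTheory intervalIntegral

noncomputable section

/-- The transfer operator for complex densities. -/
def transferC (F : ℝ → ℝ) (d : ℕ) (ρ : ℝ → ℂ) (θ : ℝ) : ℂ :=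
  ∑ i ∈ Finset.range d,
    ρ (Function.invFun F (θ + i)) * ((deriv F (Function.invFun F (θ + i)) : ℝ) : ℂ)⁻¹

/-- The transfer operator for real densities. -/
def transferR (F : ℝ → ℝ) (d : ℕ) (ρ : ℝ → ℝ) (θ : ℝ) : ℝ :=
  ∑ i ∈ Finset.range d,
    ρ (Function.invFun F (θ + i)) * (deriv F (Function.invFun F (θ + i)))⁻¹

/-- `F` is the `C²` lift of a degree `d` circle map with derivative at least `lam > 1`. -/
structure IsExpandingLift (F : ℝ → ℝ) (d : ℕ) (lam : ℝ) : Prop where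
  contDiff : ContDiff ℝ 2 F
  map_add_one : ∀ x, F (x + 1) = F x + d
  one_lt : 1 < lam
  le_deriv : ∀ x, lam ≤ deriv F x

/-- The contribution `h(F⁻¹ y) / F'(F⁻¹ y)` of the inverse branch of `F` at `y`. -/
def branchTerm {E : Type*} [NormedAddCommGroup E] [NormedSpace ℝ E]
    (F : ℝ → ℝ) (h : ℝ → E) (y : ℝ) : E :=
  (deriv F (Function.invFun F y))⁻¹ • h (Function.invFun F y)

/-- The transfer operator for densities with values in a real normed space. -/
def transfer {E : Type*} [NormedAddCommGroup E] [NormedSpace ℝ E]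
    (F : ℝ → ℝ) (d : ℕ) (h : ℝ → E) (θ : ℝ) : E :=
  ∑ i ∈ Finset.range d, branchTerm F h (θ + i)

theorem transferC_eq_transfer (F : ℝ → ℝ) (d : ℕ) (ρ : ℝ → ℂ) :
    transferC F d ρ = transfer F d ρ := by
  ext θ
  simp only [transferC, transfer, branchTerm, Complex.real_smul, Complex.ofReal_inv, mul_comm]

theorem transferR_eq_transfer (F : ℝ → ℝ) (d : ℕ) (ρ : ℝ → ℝ) :
    transferR F d ρ = transfer F d ρ := by
  ext θ
  simp only [transferR, transfer, branchTerm, smul_eq_mul, mul_comm]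

theorem Function.Periodic.deriv_of_real {E : Type*} [NormedAddCommGroup E] [NormedSpace ℝ E]
    {h : ℝ → E} {c : ℝ} (hh : Function.Periodic h c) : Function.Periodic (deriv h) c := by
  intro x
  rw [← deriv_comp_add_const]
  exact congrArg (fun k => deriv k x) (funext hh)

namespace IsExpandingLift

variable {F : ℝ → ℝ} {d : ℕ} {lam : ℝ} {E : Type*} [NormedAddCommGroup E] [NormedSpace ℝ E]

theorem deriv_pos (hF : IsExpandingLift F d lam) (x : ℝ) : 0 < deriv F x :=
  (zero_lt_one.trans hF.one_lt).trans_le (hF.le_deriv x)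

theorem differentiable (hF : IsExpandingLift F d lam) : Differentiable ℝ F :=
  hF.contDiff.differentiable two_ne_zero

theorem contDiff_deriv (hF : IsExpandingLift F d lam) : ContDiff ℝ 1 (deriv F) :=
  ((contDiff_succ_iff_deriv (n := 1)).1 (by simpa [one_add_one_eq_two] using hF.contDiff)).2.2

theorem continuous_deriv (hF : IsExpandingLift F d lam) : Continuous (deriv F) :=
  hF.contDiff_deriv.continuous

theorem continuous_deriv_deriv (hF : IsExpandingLift F d lam) : Continuous (deriv (deriv F)) :=
  (contDiff_one_iff_deriv.1 hF.contDiff_deriv).2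

theorem periodic_deriv (hF : IsExpandingLift F d lam) : Function.Periodic (deriv F) 1 := by
  intro x
  rw [← deriv_comp_add_const, show (fun y => F (y + 1)) = fun y => F y + d from
    funext hF.map_add_one, deriv_add_const]

theorem strictMono (hF : IsExpandingLift F d lam) : StrictMono F :=
  strictMono_of_deriv_pos hF.deriv_pos

theorem degree_pos (hF : IsExpandingLift F d lam) : 0 < d := by
  have h := hF.strictMono (lt_add_one (0 : ℝ))
  rw [hF.map_add_one] at h
  exact_mod_cast (lt_add_iff_pos_right _).1 h

theorem surjective (hF : IsExpandingLift F d lam) : Function.Surjective F := by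
  intro p
  have hlam := hF.one_lt
  have hmv := mul_sub_le_image_sub_of_le_deriv hF.differentiable hF.le_deriv
  have habs := abs_nonneg (p - F 0)
  refine mem_range_of_exists_le_of_exists_ge hF.differentiable.continuous
    ⟨-|p - F 0|, ?_⟩ ⟨|p - F 0|, ?_⟩
  · have := hmv (neg_nonpos.2 habs)
    nlinarith [neg_abs_le (p - F 0)]
  · have := hmv habs
    nlinarith [le_abs_self (p - F 0)]

theorem apply_invFun (hF : IsExpandingLift F d lam) (y : ℝ) : F (Function.invFun F y) = y :=
  Function.invFun_eq (hF.surjective y)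

theorem continuous_invFun (hF : IsExpandingLift F d lam) : Continuous (Function.invFun F) := by
  have h : (hF.strictMono.orderIsoOfSurjective F hF.surjective).symm = Function.invFun F :=
    funext fun y => hF.strictMono.injective <|
      (hF.strictMono.orderIsoOfSurjective_self_symm_apply F hF.surjective y).trans
        (hF.apply_invFun y).symm
  exact h ▸ (hF.strictMono.orderIsoOfSurjective F hF.surjective).symm.continuous

theorem invFun_add_degree (hF : IsExpandingLift F d lam) (y : ℝ) :
    Function.invFun F (y + d) = Function.invFun F y + 1 :=
  hF.strictMono.injective (by rw [hF.map_add_one, hF.apply_invFun, hF.apply_invFun])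

theorem hasDerivAt_invFun (hF : IsExpandingLift F d lam) (y : ℝ) :
    HasDerivAt (Function.invFun F) (deriv F (Function.invFun F y))⁻¹ y :=
  HasDerivAt.of_local_left_inverse hF.continuous_invFun.continuousAt
    (hF.differentiable _).hasDerivAt (hF.deriv_pos _).ne' (.of_forall hF.apply_invFun)

theorem continuous_inv_deriv_invFun (hF : IsExpandingLift F d lam) :
    Continuous fun y => (deriv F (Function.invFun F y))⁻¹ :=
  (hF.continuous_deriv.comp hF.continuous_invFun).inv₀ fun _ => (hF.deriv_pos _).ne'

theorem continuous_branchTerm (hF : IsExpandingLift F d lam) {h : ℝ → E} (hh : Continuous h) :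
    Continuous (branchTerm F h) :=
  hF.continuous_inv_deriv_invFun.smul (hh.comp hF.continuous_invFun)

theorem continuous_transfer (hF : IsExpandingLift F d lam) {h : ℝ → E} (hh : Continuous h) :
    Continuous (transfer F d h) :=
  continuous_finsetSum _ fun _ _ =>
    (hF.continuous_branchTerm hh).comp (continuous_id.add continuous_const)

theorem branchTerm_add_degree (hF : IsExpandingLift F d lam) {h : ℝ → E}
    (hh : Function.Periodic h 1) (y : ℝ) : branchTerm F h (y + d) = branchTerm F h y := by
  simp only [branchTerm, hF.invFun_add_degree, hF.periodic_deriv _, hh _]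

theorem periodic_transfer (hF : IsExpandingLift F d lam) {h : ℝ → E}
    (hh : Function.Periodic h 1) : Function.Periodic (transfer F d h) 1 := by
  intro θ
  have hsum := (Finset.sum_range_succ' (fun i : ℕ => branchTerm F h (θ + i)) d).symm.trans
    (Finset.sum_range_succ (fun i : ℕ => branchTerm F h (θ + i)) d)
  rw [hF.branchTerm_add_degree hh, Nat.cast_zero, add_zero, add_left_inj] at hsum
  rw [transfer, transfer, ← hsum]
  refine Finset.sum_congr rfl fun i _ => ?_
  rw [Nat.cast_succ, add_assoc, add_comm (1 : ℝ)]

theorem norm_transfer_le (hF : IsExpandingLift F d lam) {h : ℝ → E} {k : ℝ → ℝ}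
    (hk : ∀ x, ‖h x‖ ≤ k x) (θ : ℝ) : ‖transfer F d h θ‖ ≤ transfer F d k θ := by
  refine norm_sum_le_of_le _ fun i _ => ?_
  have hpos := inv_pos.2 (hF.deriv_pos (Function.invFun F (θ + i)))
  rw [branchTerm, norm_smul, Real.norm_of_nonneg hpos.le]
  exact mul_le_mul_of_nonneg_left (hk _) hpos.le

theorem transfer_pos (hF : IsExpandingLift F d lam) {k : ℝ → ℝ} (hk : ∀ x, 0 < k x) (θ : ℝ) :
    0 < transfer F d k θ :=
  Finset.sum_pos (fun _ _ => mul_pos (inv_pos.2 (hF.deriv_pos _)) (hk _))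
    (Finset.nonempty_range_iff.2 hF.degree_pos.ne')

/-- The transfer operator preserves the integral of a real density. -/
theorem integral_transfer (hF : IsExpandingLift F d lam) {k : ℝ → ℝ} (hk : Continuous k)
    (hper : Function.Periodic k 1) : ∫ θ in (0:ℝ)..1, transfer F d k θ = ∫ θ in (0:ℝ)..1, k θ := by
  have hint : ∀ a b, IntervalIntegrable (branchTerm F k) volume a b :=
    (hF.continuous_branchTerm hk).intervalIntegrable
  calc ∫ θ in (0:ℝ)..1, transfer F d k θ
      = ∑ i ∈ Finset.range d, ∫ θ in (0:ℝ)..1, branchTerm F k (θ + i) :=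
        integral_finsetSum fun i _ => ((hF.continuous_branchTerm hk).comp
          (continuous_id.add continuous_const)).intervalIntegrable _ _
    _ = ∑ i ∈ Finset.range d, ∫ θ in (i:ℝ)..((i + 1 : ℕ) : ℝ), branchTerm F k θ := by
        refine Finset.sum_congr rfl fun i _ => ?_
        rw [integral_comp_add_right (branchTerm F k), zero_add, Nat.cast_succ, add_comm (1 : ℝ)]
    _ = ∫ θ in (0:ℝ)..d, branchTerm F k θ := by
        rw [sum_integral_adjacent_intervals (a := fun i : ℕ => (i : ℝ)) fun i _ => hint _ _,
          Nat.cast_zero]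
    _ = ∫ θ in (0:ℝ)..d,
          (k ∘ Function.invFun F) θ * (deriv F (Function.invFun F θ))⁻¹ := by
        simp only [branchTerm, smul_eq_mul, mul_comm, Function.comp_apply]
    _ = ∫ y in Function.invFun F 0..Function.invFun F d, k y :=
        integral_comp_mul_deriv (fun y _ => hF.hasDerivAt_invFun y)
          hF.continuous_inv_deriv_invFun.continuousOn hk
    _ = ∫ y in (0:ℝ)..1, k y := by
        rw [← zero_add (d : ℝ), hF.invFun_add_degree, hper.intervalIntegral_add_eq _ 0, zero_add]

theorem integral_norm_transfer_le (hF : IsExpandingLift F d lam) {h : ℝ → E} (hh : Continuous h)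
    (hper : Function.Periodic h 1) :
    ∫ θ in (0:ℝ)..1, ‖transfer F d h θ‖ ≤ ∫ θ in (0:ℝ)..1, ‖h θ‖ := by
  rw [← hF.integral_transfer hh.norm fun x => congrArg norm (hper x)]
  exact integral_mono zero_le_one ((hF.continuous_transfer hh).norm.intervalIntegrable _ _)
    ((hF.continuous_transfer hh.norm).intervalIntegrable _ _)
    (hF.norm_transfer_le fun _ => le_rfl)

/-- The derivative of the transfer of `h` is the transfer of `h'/F' - (F''/(F')²) h`. -/
theorem hasDerivAt_transfer (hF : IsExpandingLift F d lam) {h : ℝ → E} (hh : Differentiable ℝ h)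
    (θ : ℝ) :
    HasDerivAt (transfer F d h)
      (transfer F d (fun y => (deriv F y)⁻¹ • deriv h y) θ
        - transfer F d (fun y => (deriv (deriv F) y / deriv F y ^ 2) • h y) θ) θ := by
  rw [transfer, transfer, ← Finset.sum_sub_distrib]
  refine HasDerivAt.fun_sum fun i _ => ?_
  refine HasDerivAt.comp_add_const (f := branchTerm F h) θ (i : ℝ) ?_
  have hinv := hF.hasDerivAt_invFun (θ + i)
  have hne := (hF.deriv_pos (Function.invFun F (θ + i))).ne'
  have hweight := (((hF.contDiff_deriv.differentiable one_ne_zero _).hasDerivAt).comp _ hinv).inv hne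
  have hval := (hh _).hasDerivAt.scomp _ hinv
  refine (hweight.smul hval).congr_deriv ?_
  simp only [branchTerm, Function.comp_apply, Pi.inv_apply, smul_smul, sub_eq_add_neg,
    ← neg_smul]
  congr 2
  field_simp

theorem norm_distortion_le (hF : IsExpandingLift F d lam) (x : ℝ) :
    ‖deriv (deriv F) x / deriv F x ^ 2‖ ≤
      sSup ((fun x => |deriv (deriv F) x| / (deriv F x) ^ 2) '' Set.Icc (0:ℝ) 1) := by
  set q : ℝ → ℝ := fun x => |deriv (deriv F) x| / (deriv F x) ^ 2 with hq
  have hcont : Continuous q :=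
    hF.continuous_deriv_deriv.abs.div (hF.continuous_deriv.pow 2)
      fun x => (pow_pos (hF.deriv_pos x) 2).ne'
  have hper : Function.Periodic q 1 := fun x => by
    simp only [hq, hF.periodic_deriv x, hF.periodic_deriv.deriv_of_real x]
  obtain ⟨y, hy, hxy⟩ := hper.exists_mem_Ico₀ one_pos x
  rw [norm_div, norm_pow, Real.norm_of_nonneg (hF.deriv_pos x).le, Real.norm_eq_abs]
  change q x ≤ _
  rw [hxy]
  exact le_csSup (isCompact_Icc.image hcont).bddAbove
    (Set.mem_image_of_mem q (Set.Ico_subset_Icc_self hy))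

theorem norm_inv_deriv_le (hF : IsExpandingLift F d lam) (x : ℝ) : ‖(deriv F x)⁻¹‖ ≤ lam⁻¹ := by
  rw [norm_inv, Real.norm_of_nonneg (hF.deriv_pos x).le]
  exact inv_anti₀ (zero_lt_one.trans hF.one_lt) (hF.le_deriv x)

theorem continuous_inv_deriv_smul_deriv (hF : IsExpandingLift F d lam) {h : ℝ → E}
    (hh : ContDiff ℝ 1 h) : Continuous fun y => (deriv F y)⁻¹ • deriv h y :=
  (hF.continuous_deriv.inv₀ fun x => (hF.deriv_pos x).ne').smul (contDiff_one_iff_deriv.1 hh).2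

theorem continuous_distortion_smul (hF : IsExpandingLift F d lam) {h : ℝ → E}
    (hh : Continuous h) : Continuous fun y => (deriv (deriv F) y / deriv F y ^ 2) • h y :=
  (hF.continuous_deriv_deriv.div (hF.continuous_deriv.pow 2)
    fun x => (pow_pos (hF.deriv_pos x) 2).ne').smul hh

theorem contDiff_transfer (hF : IsExpandingLift F d lam) {h : ℝ → E} (hh : ContDiff ℝ 1 h) :
    ContDiff ℝ 1 (transfer F d h) := by
  have hd := hF.hasDerivAt_transfer (hh.differentiable one_ne_zero)
  refine contDiff_one_iff_deriv.2 ⟨fun θ => (hd θ).differentiableAt, ?_⟩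
  rw [funext fun θ => (hd θ).deriv]
  exact (hF.continuous_transfer (hF.continuous_inv_deriv_smul_deriv hh)).sub
    (hF.continuous_transfer (hF.continuous_distortion_smul hh.continuous))

theorem integral_norm_deriv_transfer_le (hF : IsExpandingLift F d lam) {B : ℝ}
    (hB : ∀ x, ‖deriv (deriv F) x / deriv F x ^ 2‖ ≤ B) {h : ℝ → E} (hh : ContDiff ℝ 1 h)
    (hper : Function.Periodic h 1) :
    ∫ θ in (0:ℝ)..1, ‖deriv (transfer F d h) θ‖ ≤
      lam⁻¹ * (∫ θ in (0:ℝ)..1, ‖deriv h θ‖) + B * ∫ θ in (0:ℝ)..1, ‖h θ‖ := by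
  have hc₁ := hF.continuous_inv_deriv_smul_deriv hh
  have hc₂ := hF.continuous_distortion_smul hh.continuous
  have hT₁ := (hF.continuous_transfer hc₁).norm
  have hT₂ := (hF.continuous_transfer hc₂).norm
  have hp₁ : Function.Periodic (fun y => (deriv F y)⁻¹ • deriv h y) 1 := fun x => by
    simp only [hF.periodic_deriv x, hper.deriv_of_real x]
  have hp₂ : Function.Periodic (fun y => (deriv (deriv F) y / deriv F y ^ 2) • h y) 1 :=
    fun x => by simp only [hF.periodic_deriv x, hF.periodic_deriv.deriv_of_real x, hper x]
  have hd' := (contDiff_one_iff_deriv.1 hh).2.norm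
  calc ∫ θ in (0:ℝ)..1, ‖deriv (transfer F d h) θ‖
      ≤ ∫ θ in (0:ℝ)..1, (‖transfer F d (fun y => (deriv F y)⁻¹ • deriv h y) θ‖
          + ‖transfer F d (fun y => (deriv (deriv F) y / deriv F y ^ 2) • h y) θ‖) := by
        refine integral_mono zero_le_one ?_ ((hT₁.add hT₂).intervalIntegrable _ _) fun θ => ?_
        · exact (contDiff_one_iff_deriv.1
            (hF.contDiff_transfer hh)).2.norm.intervalIntegrable _ _
        · rw [(hF.hasDerivAt_transfer (hh.differentiable one_ne_zero) θ).deriv]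
          exact norm_sub_le _ _
    _ = _ := integral_add (hT₁.intervalIntegrable _ _) (hT₂.intervalIntegrable _ _)
    _ ≤ (∫ θ in (0:ℝ)..1, ‖(deriv F θ)⁻¹ • deriv h θ‖)
          + ∫ θ in (0:ℝ)..1, ‖(deriv (deriv F) θ / deriv F θ ^ 2) • h θ‖ :=
        add_le_add (hF.integral_norm_transfer_le hc₁ hp₁) (hF.integral_norm_transfer_le hc₂ hp₂)
    _ ≤ (∫ θ in (0:ℝ)..1, lam⁻¹ * ‖deriv h θ‖) + ∫ θ in (0:ℝ)..1, B * ‖h θ‖ := by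
        refine add_le_add
          (integral_mono zero_le_one (hc₁.norm.intervalIntegrable _ _)
            ((continuous_const.mul hd').intervalIntegrable _ _) fun θ => ?_)
          (integral_mono zero_le_one (hc₂.norm.intervalIntegrable _ _)
            ((continuous_const.mul hh.continuous.norm).intervalIntegrable _ _) fun θ => ?_)
        · simp only [norm_smul]
          exact mul_le_mul_of_nonneg_right (hF.norm_inv_deriv_le θ) (norm_nonneg _)
        · simp only [norm_smul]
          exact mul_le_mul_of_nonneg_right (hB θ) (norm_nonneg _)
    _ = _ := by rw [intervalIntegral.integral_const_mul, intervalIntegral.integral_const_mul]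

theorem transfer_const_mul (c : ℝ) (k : ℝ → ℝ) (θ : ℝ) :
    transfer F d (fun y => c * k y) θ = c * transfer F d k θ := by
  simp only [transfer, branchTerm, smul_eq_mul, Finset.mul_sum, mul_left_comm]

/-- The cone `{σ > 0, |σ'| ≤ a σ}` is mapped into itself by the transfer operator. -/
theorem abs_deriv_transfer_le (hF : IsExpandingLift F d lam) {B a : ℝ}
    (hB : ∀ x, ‖deriv (deriv F) x / deriv F x ^ 2‖ ≤ B) (ha : B / (1 - lam⁻¹) < a)
    {σ : ℝ → ℝ} (hσ : Differentiable ℝ σ) (hpos : ∀ θ, 0 < σ θ)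
    (hcone : ∀ θ, |deriv σ θ| ≤ a * σ θ) (θ : ℝ) :
    |deriv (transfer F d σ) θ| ≤ a * transfer F d σ θ := by
  have hgap : B < a * (1 - lam⁻¹) :=
    (div_lt_iff₀ (sub_pos.2 (inv_lt_one_of_one_lt₀ hF.one_lt))).1 ha
  have h₁ := hF.norm_transfer_le (h := fun y => (deriv F y)⁻¹ • deriv σ y)
    (k := fun y => (lam⁻¹ * a) * σ y) (fun x => by
      rw [norm_smul, mul_assoc]
      exact mul_le_mul (hF.norm_inv_deriv_le x) (hcone x) (norm_nonneg _)
        (inv_nonneg.2 (zero_le_one.trans hF.one_lt.le))) θ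
  have h₂ := hF.norm_transfer_le (h := fun y => (deriv (deriv F) y / deriv F y ^ 2) • σ y)
    (k := fun y => B * σ y) (fun x => by
      rw [norm_smul, Real.norm_of_nonneg (hpos x).le]
      exact mul_le_mul_of_nonneg_right (hB x) (hpos x).le) θ
  rw [transfer_const_mul] at h₁ h₂
  rw [(hF.hasDerivAt_transfer hσ θ).deriv, ← Real.norm_eq_abs]
  refine (norm_sub_le _ _).trans ((add_le_add h₁ h₂).trans ?_)
  nlinarith [hF.transfer_pos hpos θ]

end IsExpandingLift

/-- **Lasota–Yorke inequality for the transfer operator** (equations (A.2),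
(A.5), (A.14) of the paper): with `B = ‖F''/(F')²‖_∞`, for `ρ ∈ C¹(𝕋,ℂ)` one has
`Lρ ∈ C¹(𝕋,ℂ)`, `(Lρ)' = L(ρ'/F') − L((F''/(F')²)ρ)`, `‖Lρ‖_{L¹} ≤ ‖ρ‖_{L¹}`,
`‖(Lρ)'‖_{L¹} ≤ λ⁻¹‖ρ'‖_{L¹} + B‖ρ‖_{L¹}`; moreover for `a > B/(1-λ⁻¹)` the cone
`{ρ > 0, |ρ'| ≤ aρ}` is preserved. -/
theorem lasota_yorke
    (F : ℝ → ℝ) (hF : ContDiff ℝ 2 F) (d : ℕ) (hFlift : ∀ x, F (x + 1) = F x + d)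
    (lam : ℝ) (hlam : 1 < lam) (hexp : ∀ x, lam ≤ deriv F x)
    (B : ℝ) (hB : B = sSup ((fun x => |deriv (deriv F) x| / (deriv F x) ^ 2) '' Set.Icc (0:ℝ) 1)) :
    (∀ (ρ : ℝ → ℂ), ContDiff ℝ 1 ρ → Function.Periodic ρ 1 →
      ContDiff ℝ 1 (transferC F d ρ) ∧
      Function.Periodic (transferC F d ρ) 1 ∧
      (∀ θ : ℝ, deriv (transferC F d ρ) θ
          = transferC F d (fun y => deriv ρ y / ((deriv F y : ℝ) : ℂ)) θ
            - transferC F d (fun y => ((deriv (deriv F) y / (deriv F y) ^ 2 : ℝ) : ℂ) * ρ y) θ) ∧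
      (∫ θ in (0:ℝ)..1, ‖transferC F d ρ θ‖) ≤ (∫ θ in (0:ℝ)..1, ‖ρ θ‖) ∧
      (∫ θ in (0:ℝ)..1, ‖deriv (transferC F d ρ) θ‖)
          ≤ lam⁻¹ * (∫ θ in (0:ℝ)..1, ‖deriv ρ θ‖) + B * (∫ θ in (0:ℝ)..1, ‖ρ θ‖)) ∧
    (∀ a : ℝ, B / (1 - lam⁻¹) < a →
      ∀ σ : ℝ → ℝ, ContDiff ℝ 1 σ → Function.Periodic σ 1 →
        (∀ θ, 0 < σ θ) → (∀ θ, |deriv σ θ| ≤ a * σ θ) →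
        (∀ θ, 0 < transferR F d σ θ) ∧
        (∀ θ, |deriv (transferR F d σ) θ| ≤ a * transferR F d σ θ)) := by
  have hL : IsExpandingLift F d lam := ⟨hF, hFlift, hlam, hexp⟩
  have hdist : ∀ x, ‖deriv (deriv F) x / deriv F x ^ 2‖ ≤ B := hB ▸ hL.norm_distortion_le
  refine ⟨fun ρ hρ hper => ?_, fun a ha σ hσ _ hpos hcone => ?_⟩
  · simp only [transferC_eq_transfer]
    refine ⟨hL.contDiff_transfer hρ, hL.periodic_transfer hper, fun θ => ?_,
      hL.integral_norm_transfer_le hρ.continuous hper,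
      hL.integral_norm_deriv_transfer_le hdist hρ hper⟩
    simpa only [Complex.real_smul, Complex.ofReal_inv, div_eq_inv_mul] using
      (hL.hasDerivAt_transfer (hρ.differentiable one_ne_zero) θ).deriv
  · rw [transferR_eq_transfer]
    exact ⟨hL.transfer_pos hpos,
      hL.abs_deriv_transfer_le hdist ha (hσ.differentiable one_ne_zero) hpos hcone⟩

end
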